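/- Let n ≥ 2 and let Ω ⊂ ℝⁿ be a bounded domain. Suppose there exist constants C ≥ 1, λ ≥ 1 and A > 0 such that for every locally Lipschitz function u : Ω → ℝ, every x₀ ∈ Ω and every 0 < r < diam(Ω) with 0 < ∫_{B(x₀,λr)∩Ω} |∇u(y)|ⁿ dy < ∞, one has inf_{c∈ℝ} ∫_{B(x₀,r)∩Ω} exp( (A |u(y) − c| / (∫_{B(x₀,λr)∩Ω} |∇u(z)|ⁿ dz)^{1/n})^{n/(n−1)} ) dy ≤ C |B(x₀,r)|. Then Ω is LLC. -/

import Mathlib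

open Set Metric MeasureTheory ENNReal NNReal

noncomputable section

/-- Euclidean space `ℝⁿ`. -/
abbrev Euc (n : ℕ) : Type := EuclideanSpace ℝ (Fin n)

/-- `u` is locally Lipschitz on the set `Ω`. -/
def LocallyLipschitzOnSet {n : ℕ} (u : Euc n → ℝ) (Ω : Set (Euc n)) : Prop :=
  ∀ x ∈ Ω, ∃ K : ℝ≥0, ∃ s ∈ nhdsWithin x Ω, LipschitzOnWith K u s

/-- `x` and `y` are joined by a (continuous) curve lying in `S`. -/
def JoinedByCurveIn {n : ℕ} (S : Set (Euc n)) (x y : Euc n) : Prop :=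
  ∃ γ : ℝ → Euc n, ContinuousOn γ (Icc 0 1) ∧ γ 0 = x ∧ γ 1 = y ∧ MapsTo γ (Icc 0 1) S

/-- `γ` is parametrized by arclength on `[0, L]`. -/
def ArclengthOn {n : ℕ} (γ : ℝ → Euc n) (L : ℝ) : Prop :=
  ∀ s t : ℝ, 0 ≤ s → s ≤ t → t ≤ L → eVariationOn γ (Icc s t) = ENNReal.ofReal (t - s)

/-- `Ω` is an `ε₀`-uniform domain. -/
def IsUniformWith {n : ℕ} (Ω : Set (Euc n)) (ε₀ : ℝ) : Prop :=
  ∀ x ∈ Ω, ∀ y ∈ Ω, ∃ γ : ℝ → Euc n,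
    ContinuousOn γ (Icc 0 1) ∧ γ 0 = x ∧ γ 1 = y ∧ MapsTo γ (Icc 0 1) Ω ∧
    eVariationOn γ (Icc 0 1) ≤ ENNReal.ofReal (dist x y / ε₀) ∧
    ∀ t ∈ Icc (0:ℝ) 1,
      ε₀ * (dist x (γ t) * dist y (γ t)) / dist x y ≤ infDist (γ t) (frontier Ω)

/-- `Ω` is a uniform domain. -/
def IsUniformDomain {n : ℕ} (Ω : Set (Euc n)) : Prop :=
  ∃ ε₀ : ℝ, 0 < ε₀ ∧ ε₀ ≤ 1 ∧ IsUniformWith Ω ε₀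

/-- `Ω` is an `α`-cigar domain: any two points can be joined by a rectifiable
(arclength-parametrized) curve in `Ω` along which
`∫_γ dist(z, ∂Ω)^(α-1) |dz| ≤ C |x - y|^α`. -/
def IsCigarDomain {n : ℕ} (Ω : Set (Euc n)) (α : ℝ) : Prop :=
  ∃ C : ℝ, 0 < C ∧ ∀ x ∈ Ω, ∀ y ∈ Ω, ∃ L : ℝ, 0 ≤ L ∧ ∃ γ : ℝ → Euc n,
    γ 0 = x ∧ γ L = y ∧ MapsTo γ (Icc 0 L) Ω ∧ ArclengthOn γ L ∧
    (∫⁻ t in Icc (0:ℝ) L, ENNReal.ofReal (infDist (γ t) (frontier Ω) ^ (α - 1)) ∂volume)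
      ≤ ENNReal.ofReal (C * dist x y ^ α)

/-- `Ω` is a `c₀`-John domain. -/
def IsJohnDomain {n : ℕ} (Ω : Set (Euc n)) (c₀ : ℝ) : Prop :=
  ∃ x₀ ∈ Ω, ∀ x ∈ Ω, ∃ l : ℝ, 0 ≤ l ∧ ∃ γ : ℝ → Euc n,
    γ 0 = x ∧ γ l = x₀ ∧ MapsTo γ (Icc 0 l) Ω ∧ ArclengthOn γ l ∧
    ∀ t ∈ Icc (0:ℝ) l, c₀ * t ≤ infDist (γ t) (frontier Ω)

/-- `Ω` has the `C`-slice property with respect to `x₀`. -/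
def HasSliceProperty {n : ℕ} (Ω : Set (Euc n)) (C : ℝ) (x₀ : Euc n) : Prop :=
  ∀ x ∈ Ω, ∃ γ : ℝ → Euc n,
    ContinuousOn γ (Icc 0 1) ∧ γ 0 = x₀ ∧ γ 1 = x ∧ MapsTo γ (Icc 0 1) Ω ∧
    ∃ j : ℕ, ∃ U : Fin (j + 1) → Set (Euc n),
      (∀ i, IsOpen (U i) ∧ U i ⊆ Ω) ∧
      (Pairwise fun i₁ i₂ => Disjoint (U i₁) (U i₂)) ∧
      -- (1)
      x₀ ∈ U 0 ∧ x ∈ U (Fin.last j) ∧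
      (∀ i : Fin (j + 1), 0 < (i : ℕ) → (i : ℕ) < j →
        x₀ ∈ Ω \ closure (U i) ∧ x ∈ Ω \ closure (U i) ∧
        x ∉ connectedComponentIn (Ω \ closure (U i)) x₀) ∧
      -- (2)
      (∀ i : Fin (j + 1), 0 < (i : ℕ) → (i : ℕ) < j →
        ∀ γ' : ℝ → Euc n, ContinuousOn γ' (Icc 0 1) → MapsTo γ' (Icc 0 1) Ω →
          (∃ t ∈ Icc (0:ℝ) 1, γ' t = x) → (∃ t ∈ Icc (0:ℝ) 1, γ' t = x₀) →
          ENNReal.ofReal (diam (U i)) ≤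
            ENNReal.ofReal C * eVariationOn γ' {t ∈ Icc (0:ℝ) 1 | γ' t ∈ U i}) ∧
      -- (3)
      (∀ t ∈ Icc (0:ℝ) 1,
        ball (γ t) (infDist (γ t) (frontier Ω) / C) ⊆ ⋃ i, closure (U i)) ∧
      -- (4)
      (∀ i : Fin (j + 1), ∀ t ∈ Icc (0:ℝ) 1, γ t ∈ U i →
        diam (U i) ≤ C * infDist (γ t) (frontier Ω)) ∧
      (∀ i : Fin (j + 1), ∃ xi ∈ U i, (∃ t ∈ Icc (0:ℝ) 1, γ t = xi) ∧
        ((i : ℕ) = j → xi = x) ∧ ball xi (infDist xi (frontier Ω) / C) ⊆ U i)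

/-- `Ω` satisfies the slice condition. -/
def SliceCondition {n : ℕ} (Ω : Set (Euc n)) : Prop :=
  ∃ C : ℝ, 1 < C ∧ ∀ x₀ ∈ Ω, HasSliceProperty Ω C x₀

/-- `Ω` is LLC. -/
def IsLLC {n : ℕ} (Ω : Set (Euc n)) : Prop :=
  ∃ b : ℝ, 0 < b ∧ b ≤ 1 ∧ ∀ z : Euc n, ∀ r : ℝ, 0 < r →
    (∀ x ∈ Ω ∩ ball z r, ∀ y ∈ Ω ∩ ball z r, JoinedByCurveIn (Ω ∩ ball z (r / b)) x y) ∧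
    (∀ x ∈ Ω \ ball z r, ∀ y ∈ Ω \ ball z r, JoinedByCurveIn (Ω \ ball z (b * r)) x y)

/-- `Ω` is quasiconvex. -/
def IsQuasiconvex {n : ℕ} (Ω : Set (Euc n)) : Prop :=
  ∃ C : ℝ, 1 ≤ C ∧ ∀ x ∈ Ω, ∀ y ∈ Ω, ∃ γ : ℝ → Euc n,
    ContinuousOn γ (Icc 0 1) ∧ γ 0 = x ∧ γ 1 = y ∧ MapsTo γ (Icc 0 1) Ω ∧
    eVariationOn γ (Icc 0 1) ≤ ENNReal.ofReal (C * dist x y)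

/-- The intrinsic (inner) metric of `Ω` (`∞` if there is no rectifiable curve). -/
def intrinsicDist {n : ℕ} (Ω : Set (Euc n)) (x y : Euc n) : ℝ≥0∞ :=
  ⨅ (γ : ℝ → Euc n)
    (_ : ContinuousOn γ (Icc 0 1) ∧ γ 0 = x ∧ γ 1 = y ∧ MapsTo γ (Icc 0 1) Ω),
    eVariationOn γ (Icc 0 1)

/-- The intrinsic ball `B_Ω(x, r)`. -/
def intrinsicBall {n : ℕ} (Ω : Set (Euc n)) (x : Euc n) (r : ℝ) : Set (Euc n) :=
  {y ∈ Ω | intrinsicDist Ω x y < ENNReal.ofReal r}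

/-- `Ω` is intrinsic Ahlfors `n`-regular. -/
def IntrinsicAhlforsRegular {n : ℕ} (Ω : Set (Euc n)) : Prop :=
  ∃ c : ℝ, 0 < c ∧ c < 1 ∧ ∃ r₀ : ℝ, 0 < r₀ ∧ ∀ x ∈ Ω, ∀ r : ℝ, 0 < r → r < r₀ →
    ENNReal.ofReal c * volume (ball x r) ≤ volume (intrinsicBall Ω x r)

/-- `Ω` is a local Sobolev–Poincaré imbedding domain of order `p`, `1 ≤ p < n`. -/
def LocalSPLow (n : ℕ) (Ω : Set (Euc n)) (p : ℝ) : Prop :=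
  ∃ C : ℝ, 1 ≤ C ∧ ∃ lam : ℝ, 1 ≤ lam ∧
    ∀ u : Euc n → ℝ, LocallyLipschitzOnSet u Ω →
      ∀ x ∈ Ω, ∀ r : ℝ, 0 < r → r < diam Ω →
        (⨅ c : ℝ, (∫⁻ y in ball x r ∩ Ω,
            ENNReal.ofReal |u y - c| ^ ((n : ℝ) * p / ((n : ℝ) - p)) ∂volume)
              ^ (((n : ℝ) - p) / ((n : ℝ) * p)))
          ≤ ENNReal.ofReal C *
            (∫⁻ y in ball x (lam * r) ∩ Ω,
              ENNReal.ofReal ‖fderiv ℝ u y‖ ^ p ∂volume) ^ (1 / p)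

/-- `Ω` is a local Sobolev–Poincaré imbedding domain of order `n`
(local Trudinger inequality). -/
def LocalSPn (n : ℕ) (Ω : Set (Euc n)) : Prop :=
  ∃ C : ℝ, 1 ≤ C ∧ ∃ lam : ℝ, 1 ≤ lam ∧ ∃ A : ℝ, 0 < A ∧
    ∀ u : Euc n → ℝ, LocallyLipschitzOnSet u Ω →
      ∀ x ∈ Ω, ∀ r : ℝ, 0 < r → r < diam Ω →
        0 < (∫⁻ y in ball x (lam * r) ∩ Ω,
              ENNReal.ofReal ‖fderiv ℝ u y‖ ^ (n : ℝ) ∂volume) →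
        (∫⁻ y in ball x (lam * r) ∩ Ω,
              ENNReal.ofReal ‖fderiv ℝ u y‖ ^ (n : ℝ) ∂volume) < ⊤ →
        (⨅ c : ℝ, ∫⁻ y in ball x r ∩ Ω,
            ENNReal.ofReal (Real.exp ((A * |u y - c| /
              (∫⁻ z in ball x (lam * r) ∩ Ω,
                ENNReal.ofReal ‖fderiv ℝ u z‖ ^ (n : ℝ) ∂volume).toReal
                  ^ ((1 : ℝ) / (n : ℝ))) ^ ((n : ℝ) / ((n : ℝ) - 1)))) ∂volume)
          ≤ ENNReal.ofReal C * volume (ball x r)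

/-- `Ω` is a local Sobolev–Poincaré imbedding domain of order `p`, `n < p < ∞`
(local Morrey inequality). -/
def LocalSPHigh (n : ℕ) (Ω : Set (Euc n)) (p : ℝ) : Prop :=
  ∃ C : ℝ, 1 ≤ C ∧ ∃ lam : ℝ, 1 ≤ lam ∧
    ∀ u : Euc n → ℝ, LocallyLipschitzOnSet u Ω →
      ∀ x ∈ Ω, ∀ r : ℝ, 0 < r → r < diam Ω →
        ∀ x₁ ∈ ball x r ∩ Ω, ∀ x₂ ∈ ball x r ∩ Ω,
          ENNReal.ofReal |u x₁ - u x₂| ≤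
            ENNReal.ofReal (C * dist x₁ x₂ ^ (1 - (n : ℝ) / p)) *
              (∫⁻ y in ball x (lam * r) ∩ Ω,
                ENNReal.ofReal ‖fderiv ℝ u y‖ ^ p ∂volume) ^ (1 / p)

/-- `Ω` is a `p`-Poincaré domain. -/
def PoincareDomain (n : ℕ) (Ω : Set (Euc n)) (p : ℝ) : Prop :=
  ∃ C : ℝ, 1 ≤ C ∧ ∃ lam : ℝ, 1 ≤ lam ∧
    ∀ u : Euc n → ℝ, LocallyLipschitzOnSet u Ω →
      ∀ x ∈ Ω, ∀ r : ℝ, 0 < r → r < diam Ω →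
        (volume (ball x r ∩ Ω))⁻¹ *
          (∫⁻ y in ball x r ∩ Ω,
            ENNReal.ofReal |u y - ⨍ z in ball x r ∩ Ω, u z ∂volume| ∂volume)
          ≤ ENNReal.ofReal (C * r) *
            ((volume (ball x (lam * r) ∩ Ω))⁻¹ *
              ∫⁻ y in ball x (lam * r) ∩ Ω,
                ENNReal.ofReal ‖fderiv ℝ u y‖ ^ p ∂volume) ^ (1 / p)


lemma exp_trudinger_lower {n : ℕ} (hn : 2 ≤ n) {A a I J : ℝ} (hA : 0 < A) (ha : 1 / 4 ≤ a)
    (hI : 0 < I) (hIJ : I ≤ J) :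
    (A / 4) ^ (2 * n) / J ^ 2 / (2 * (n - 1)).factorial ≤
      Real.exp ((A * a / I ^ ((1 : ℝ) / (n : ℝ))) ^ ((n : ℝ) / ((n : ℝ) - 1))) := by
  have hn' : (2 : ℝ) ≤ n := by exact_mod_cast hn
  set B := A * a / I ^ ((1 : ℝ) / (n : ℝ)) with hB
  have hIr : 0 < I ^ ((1 : ℝ) / (n : ℝ)) := Real.rpow_pos_of_pos hI _
  have hBpos : 0 < B := by positivity
  have hpow : (B ^ ((n : ℝ) / ((n : ℝ) - 1))) ^ (2 * (n - 1)) = B ^ (2 * n) := by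
    rw [← Real.rpow_natCast, ← Real.rpow_mul hBpos.le, ← Real.rpow_natCast B]
    congr 1
    push_cast [Nat.cast_sub (show 1 ≤ n by omega)]
    have : (n : ℝ) - 1 ≠ 0 := by linarith
    field_simp
  have hIpow : (I ^ ((1 : ℝ) / (n : ℝ))) ^ (2 * n) = I ^ 2 := by
    rw [← Real.rpow_natCast, ← Real.rpow_mul hI.le, ← Real.rpow_natCast I]
    congr 1
    push_cast
    field_simp
  refine le_trans ?_ (Real.pow_div_factorial_le_exp _ (Real.rpow_nonneg hBpos.le _) (2 * (n - 1)))
  rw [hpow, hB, div_pow (A * a), hIpow]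
  have hJ : 0 < J := hI.trans_le hIJ
  gcongr
  nlinarith

/-- Two-set consequence of the local Trudinger inequality for a single function. -/
lemma trudinger_two_sets_aux {n : ℕ} (hn : 2 ≤ n) {Ω : Set (Euc n)} {C A r lr J m : ℝ}
    {u : Euc n → ℝ} {x : Euc n} {E F : Set (Euc n)} (hA : 0 < A) (hC : 1 ≤ C) (hr : 0 < r)
    (hpos : 0 < ∫⁻ y in ball x lr ∩ Ω, ENNReal.ofReal ‖fderiv ℝ u y‖ ^ (n : ℝ) ∂volume)
    (hJ : ∫⁻ y in ball x lr ∩ Ω, ENNReal.ofReal ‖fderiv ℝ u y‖ ^ (n : ℝ) ∂volume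
      ≤ ENNReal.ofReal J)
    (hT : (⨅ c : ℝ, ∫⁻ y in ball x r ∩ Ω,
            ENNReal.ofReal (Real.exp ((A * |u y - c| /
              (∫⁻ z in ball x lr ∩ Ω,
                ENNReal.ofReal ‖fderiv ℝ u z‖ ^ (n : ℝ) ∂volume).toReal
                  ^ ((1 : ℝ) / (n : ℝ))) ^ ((n : ℝ) / ((n : ℝ) - 1)))) ∂volume)
          ≤ ENNReal.ofReal C * volume (ball x r))
    (hE : E ⊆ ball x r ∩ Ω) (hF : F ⊆ ball x r ∩ Ω)
    (hEm : MeasurableSet E) (hFm : MeasurableSet F)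
    (hgap : ∀ p ∈ E, ∀ q ∈ F, 1 / 2 ≤ u p - u q)
    (hmE : ENNReal.ofReal m ≤ volume E) (hmF : ENNReal.ofReal m ≤ volume F) :
    (A / 4) ^ (2 * n) / (2 * (n - 1)).factorial / (C * (volume (ball (0 : Euc n) 1)).toReal) * m
      ≤ J ^ 2 * r ^ n := by
  have : Nontrivial (Euc n) := by
    have : Nonempty (Fin n) := ⟨⟨0, by omega⟩⟩
    infer_instance
  set I := ∫⁻ y in ball x lr ∩ Ω, ENNReal.ofReal ‖fderiv ℝ u y‖ ^ (n : ℝ) ∂volume with hI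
  have hItop : I ≠ ⊤ := ne_top_of_le_ne_top ENNReal.ofReal_ne_top hJ
  have hI0 : 0 < I.toReal := ENNReal.toReal_pos hpos.ne' hItop
  have hJ0 : 0 < J := ENNReal.ofReal_pos.1 (hpos.trans_le hJ)
  have hIJ : I.toReal ≤ J := ENNReal.toReal_le_of_le_ofReal hJ0.le hJ
  set κ := (A / 4) ^ (2 * n) / J ^ 2 / (2 * (n - 1)).factorial with hκ
  have hκ0 : 0 < κ := by positivity
  have key : ∀ (G : Set (Euc n)) (c : ℝ), MeasurableSet G → G ⊆ ball x r ∩ Ω →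
      ENNReal.ofReal m ≤ volume G → (∀ p ∈ G, 1 / 4 ≤ |u p - c|) →
      ENNReal.ofReal κ * ENNReal.ofReal m ≤ ∫⁻ y in ball x r ∩ Ω,
            ENNReal.ofReal (Real.exp ((A * |u y - c| / I.toReal
                  ^ ((1 : ℝ) / (n : ℝ))) ^ ((n : ℝ) / ((n : ℝ) - 1)))) ∂volume := by
    intro G c hGm hG hmG hc
    calc ENNReal.ofReal κ * ENNReal.ofReal m ≤ ENNReal.ofReal κ * volume G := by gcongr
      _ = ∫⁻ y in G, ENNReal.ofReal κ ∂volume := by rw [setLIntegral_const]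
      _ ≤ ∫⁻ y in G, ENNReal.ofReal (Real.exp ((A * |u y - c| / I.toReal
                  ^ ((1 : ℝ) / (n : ℝ))) ^ ((n : ℝ) / ((n : ℝ) - 1)))) ∂volume := by
          refine setLIntegral_mono' hGm fun p hp => ENNReal.ofReal_le_ofReal ?_
          exact exp_trudinger_lower hn hA (hc p hp) hI0 hIJ
      _ ≤ _ := lintegral_mono_set hG
  have hmain : ENNReal.ofReal κ * ENNReal.ofReal m ≤ ENNReal.ofReal C * volume (ball x r) := by
    refine le_trans (le_iInf fun c => ?_) hT
    by_cases hcase : ∀ p ∈ E, 1 / 4 ≤ |u p - c|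
    · exact key E c hEm hE hmE hcase
    · push Not at hcase
      obtain ⟨p, hp, hpc⟩ := hcase
      refine key F c hFm hF hmF fun q hq => ?_
      have := hgap p hp q hq
      rw [abs_lt] at hpc
      rw [le_abs]
      right
      linarith
  have hv0 : 0 < (volume (ball (0 : Euc n) 1)).toReal :=
    ENNReal.toReal_pos (measure_ball_pos _ _ one_pos).ne' measure_ball_lt_top.ne
  have hvol : volume (ball x r) = ENNReal.ofReal (r ^ n * (volume (ball (0 : Euc n) 1)).toReal) := by
    rw [Measure.addHaar_ball _ _ hr.le, ENNReal.ofReal_mul (by positivity),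
      ENNReal.ofReal_toReal measure_ball_lt_top.ne]
    simp
  rw [hvol, ← ENNReal.ofReal_mul hκ0.le, ← ENNReal.ofReal_mul (by linarith),
    ENNReal.ofReal_le_ofReal_iff (by positivity)] at hmain
  set v := (volume (ball (0 : Euc n) 1)).toReal
  have hC0 : 0 < C := by linarith
  have e1 : (A / 4) ^ (2 * n) / (2 * (n - 1)).factorial / (C * v) * m = κ * m * (J ^ 2 / (C * v)) := by
    rw [hκ]; field_simp
  have e2 : J ^ 2 * r ^ n = C * (r ^ n * v) * (J ^ 2 / (C * v)) := by
    field_simp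
  rw [e1, e2]
  gcongr

/-- Capacity lower bound: under the local Trudinger inequality, a function separating two sets
of measure at least `m` in a ball of radius `r` has energy bounded from below. -/
lemma LocalSPn.exists_two_sets_bound {n : ℕ} (hn : 2 ≤ n) {Ω : Set (Euc n)} (hOpen : IsOpen Ω)
    (hSP : LocalSPn n Ω) :
    ∃ c : ℝ, 0 < c ∧ ∀ u : Euc n → ℝ, LocallyLipschitzOnSet u Ω →
      ∀ x ∈ Ω, ∀ r : ℝ, 0 < r → r < diam Ω → ∀ J : ℝ, 0 < J →
      ∫⁻ y in Ω, ENNReal.ofReal ‖fderiv ℝ u y‖ ^ (n : ℝ) ∂volume ≤ ENNReal.ofReal J →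
      ∀ E F : Set (Euc n), E ⊆ ball x r ∩ Ω → F ⊆ ball x r ∩ Ω →
      MeasurableSet E → MeasurableSet F → (∀ p ∈ E, 1 ≤ u p) → (∀ p ∈ F, u p ≤ 0) →
      ∀ m : ℝ, ENNReal.ofReal m ≤ volume E → ENNReal.ofReal m ≤ volume F →
      c * m ≤ J ^ 2 * r ^ n := by
  obtain ⟨C, hC, lam, hlam, A, hA, hT⟩ := hSP
  have hne : Nonempty (Fin n) := ⟨⟨0, by omega⟩⟩
  have : Nontrivial (Euc n) := inferInstance
  have hv0 : 0 < (volume (ball (0 : Euc n) 1)).toReal :=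
    ENNReal.toReal_pos (measure_ball_pos _ _ one_pos).ne' measure_ball_lt_top.ne
  have hn0 : (0 : ℝ) < n := by positivity
  refine ⟨(A / 4) ^ (2 * n) / (2 * (n - 1)).factorial /
    (C * (volume (ball (0 : Euc n) 1)).toReal), by positivity, ?_⟩
  intro u hu x hx r hr hrd J hJ0 hJ E F hE hF hEm hFm hu1 hu0 m hmE hmF
  have hJ' := (lintegral_mono_set (inter_subset_right (s := ball x (lam * r)) (t := Ω))).trans hJ
  rcases eq_or_ne (∫⁻ y in ball x (lam * r) ∩ Ω,
    ENNReal.ofReal ‖fderiv ℝ u y‖ ^ (n : ℝ) ∂volume) 0 with hz | hz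
  swap
  · have hpos := pos_iff_ne_zero.2 hz
    refine trudinger_two_sets_aux hn hA hC hr hpos hJ'
      (hT u hu x hx r hr hrd hpos (hJ'.trans_lt ENNReal.ofReal_lt_top)) hE hF hEm hFm ?_ hmE hmF
    intro p hp q hq
    linarith [hu1 p hp, hu0 q hq]
  -- the energy of `u` vanishes near `x`: perturb `u` by a small linear function
  obtain ⟨i⟩ := hne
  set l : Euc n →L[ℝ] ℝ := innerSL ℝ (EuclideanSpace.single i (1 : ℝ)) with hl
  have hlnorm : ‖l‖ = 1 := by
    rw [hl, innerSL_apply_norm]; simp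
  have hlr : 0 < lam * r := by nlinarith
  set S := ball x (lam * r) ∩ Ω with hS
  have hSo : IsOpen S := isOpen_ball.inter hOpen
  have hxS : x ∈ S := ⟨mem_ball_self hlr, hx⟩
  have hStop : volume S < ⊤ := (measure_mono inter_subset_left).trans_lt measure_ball_lt_top
  set V := (volume S).toReal with hV
  have hae : ∀ᵐ y ∂(volume.restrict S), fderiv ℝ u y = 0 := by
    rw [lintegral_eq_zero_iff] at hz
    · filter_upwards [hz] with y hy
      rcases ENNReal.rpow_eq_zero_iff.1 hy with h | h
      · exact norm_le_zero_iff.1 (ENNReal.ofReal_eq_zero.1 h.1)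
      · exact absurd h.1 ENNReal.ofReal_ne_top
    · have := (measurable_fderiv ℝ u).norm
      fun_prop
  obtain ⟨ε, hε0, hε1, hε2⟩ : ∃ ε : ℝ, 0 < ε ∧ ε * (2 * r) ≤ 1 / 2 ∧ ε ^ n * V ≤ J := by
    have hcont : ∀ᶠ ε : ℝ in nhds 0, ε * (2 * r) < 1 / 2 ∧ ε ^ n * V < J := by
      refine Filter.Eventually.and ?_ ?_
      · refine Filter.Tendsto.eventually_lt_const (v := 0 * (2 * r)) (by norm_num) ?_
        exact (by fun_prop : Continuous fun ε : ℝ => ε * (2 * r)).tendsto 0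
      · refine Filter.Tendsto.eventually_lt_const (v := 0 ^ n * V) ?_ ?_
        · rw [zero_pow (by omega)]; simpa
        exact (by fun_prop : Continuous fun ε : ℝ => ε ^ n * V).tendsto 0
    obtain ⟨ε, h, h'⟩ := ((hcont.filter_mono (nhdsWithin_le_nhds (s := Ioi 0))).and
      self_mem_nhdsWithin).exists
    exact ⟨ε, h', h.1.le, h.2.le⟩
  set v : Euc n → ℝ := fun y => u y + ε * l y with hv
  have hvl : LocallyLipschitzOnSet v Ω := by
    intro y hy
    obtain ⟨K, s, hs, hK⟩ := hu y hy
    have hlip : LipschitzOnWith (‖ε • l‖₊) (ε • l) s := (ε • l).lipschitz.lipschitzOnWith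
    exact ⟨K + ‖ε • l‖₊, s, hs, hK.add hlip⟩
  have hfd : ∀ y, DifferentiableAt ℝ u y → fderiv ℝ v y = fderiv ℝ u y + ε • l := by
    intro y hy
    exact (hy.hasFDerivAt.add (ε • l).hasFDerivAt).fderiv
  have hle : ∀ᵐ y ∂(volume.restrict S), ‖fderiv ℝ v y‖ ≤ ε := by
    filter_upwards [hae] with y hy
    by_cases hd : DifferentiableAt ℝ u y
    · rw [hfd y hd, hy, zero_add, norm_smul, hlnorm, Real.norm_of_nonneg hε0.le, mul_one]
    · have hd' : ¬ DifferentiableAt ℝ v y := by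
        intro h
        apply hd
        have := h.sub (ε • l).differentiableAt
        refine this.congr_of_eventuallyEq (Filter.Eventually.of_forall fun z => ?_)
        simp [hv]
      rw [fderiv_zero_of_not_differentiableAt hd', norm_zero]
      exact hε0.le
  have hvJ : ∫⁻ y in S, ENNReal.ofReal ‖fderiv ℝ v y‖ ^ (n : ℝ) ∂volume ≤ ENNReal.ofReal J := by
    calc ∫⁻ y in S, ENNReal.ofReal ‖fderiv ℝ v y‖ ^ (n : ℝ) ∂volume
        ≤ ∫⁻ y in S, ENNReal.ofReal ε ^ (n : ℝ) ∂volume := by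
          refine lintegral_mono_ae ?_
          filter_upwards [hle] with y hy
          gcongr
      _ = ENNReal.ofReal ε ^ n * volume S := by rw [setLIntegral_const, ENNReal.rpow_natCast]
      _ = ENNReal.ofReal (ε ^ n * V) := by
          rw [ENNReal.ofReal_mul (by positivity), ENNReal.ofReal_pow hε0.le,
            ENNReal.ofReal_toReal hStop.ne]
      _ ≤ _ := ENNReal.ofReal_le_ofReal hε2
  have hvpos : 0 < ∫⁻ y in S, ENNReal.ofReal ‖fderiv ℝ v y‖ ^ (n : ℝ) ∂volume := by
    obtain ⟨K, s, hs, hK⟩ := hu x hx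
    rw [hOpen.nhdsWithin_eq hx] at hs
    obtain ⟨T, hTs, hTo, hxT⟩ := _root_.mem_nhds_iff.1 (Filter.inter_mem hs (hSo.mem_nhds hxS))
    have hKT : LipschitzOnWith K u T := hK.mono (hTs.trans inter_subset_left)
    have hTS : T ⊆ S := hTs.trans inter_subset_right
    have hdiff : ∀ᵐ y ∂(volume.restrict T), ENNReal.ofReal ε ^ (n : ℝ)
        ≤ ENNReal.ofReal ‖fderiv ℝ v y‖ ^ (n : ℝ) := by
      filter_upwards [hKT.ae_differentiableWithinAt hTo.measurableSet,
        ae_restrict_mem hTo.measurableSet, ae_mono (Measure.restrict_mono hTS le_rfl) hae]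
        with y hy hyT hy0
      rw [hfd y (hy.differentiableAt (hTo.mem_nhds hyT)), hy0, zero_add, norm_smul, hlnorm,
        Real.norm_of_nonneg hε0.le, mul_one]
    calc 0 < ENNReal.ofReal ε ^ (n : ℝ) * volume T := by
          refine ENNReal.mul_pos ?_ (hTo.measure_pos _ ⟨x, hxT⟩).ne'
          rw [ENNReal.rpow_natCast]
          exact pow_ne_zero _ (ENNReal.ofReal_pos.2 hε0).ne'
      _ = ∫⁻ y in T, ENNReal.ofReal ε ^ (n : ℝ) ∂volume := by rw [setLIntegral_const]
      _ ≤ ∫⁻ y in T, ENNReal.ofReal ‖fderiv ℝ v y‖ ^ (n : ℝ) ∂volume := lintegral_mono_ae hdiff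
      _ ≤ _ := lintegral_mono_set hTS
  refine trudinger_two_sets_aux hn hA hC hr hvpos hvJ
      (hT v hvl x hx r hr hrd hvpos (hvJ.trans_lt ENNReal.ofReal_lt_top)) hE hF hEm hFm ?_ hmE hmF
  intro p hp q hq
  have h1 := hu1 p hp
  have h0 := hu0 q hq
  have hpq : |l q - l p| ≤ 2 * r := by
    rw [← map_sub]
    have h2 := l.le_opNorm (q - p)
    rw [hlnorm, one_mul, Real.norm_eq_abs, ← dist_eq_norm] at h2
    have h3 := dist_triangle_right q p x
    have h4 := (hE hp).1
    have h5 := (hF hq).1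
    rw [mem_ball] at h4 h5
    linarith
  have := (abs_le.1 hpq).2
  simp only [hv]
  nlinarith

lemma LipschitzOnWith.indicator_of_clopen_piece {n : ℕ} {Ω U W S : Set (Euc n)} {g : Euc n → ℝ}
    {K : ℝ≥0} (hS : Convex ℝ S) (hSΩ : S ⊆ Ω) (hU : IsOpen U)
    (hrest : IsOpen ((Ω ∩ W) \ U)) (hg0 : ∀ w, w ∉ W → g w = 0)
    (hg : LipschitzOnWith K g S) : LipschitzOnWith K (U.indicator g) S := by
  have key : ∀ p ∈ S, ∀ q ∈ S, p ∈ U → q ∉ U → |g p| ≤ K * dist p q := by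
    intro p hp q hq hpU hqU
    have hseg : segment ℝ p q ⊆ S := hS.segment_subset hp hq
    obtain ⟨s, hs, hsW⟩ : ∃ s ∈ segment ℝ p q, s ∉ W := by
      by_contra! hcon
      have hconn : IsPreconnected (segment ℝ p q) := (convex_segment p q).isPreconnected
      obtain ⟨y, -, hy1, hy2⟩ := hconn U ((Ω ∩ W) \ U) hU hrest
        (fun y hy => by
          by_cases hyU : y ∈ U
          · exact Or.inl hyU
          · exact Or.inr ⟨⟨hSΩ (hseg hy), hcon y hy⟩, hyU⟩)
        ⟨p, left_mem_segment ℝ p q, hpU⟩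
        ⟨q, right_mem_segment ℝ p q,
          ⟨hSΩ hq, hcon q (right_mem_segment ℝ p q)⟩, hqU⟩
      exact hy2.2 hy1
    have h1 := hg.dist_le_mul p hp s (hseg hs)
    rw [hg0 s hsW, Real.dist_eq, sub_zero] at h1
    refine h1.trans ?_
    have := dist_add_dist_of_mem_segment hs
    gcongr
    linarith [dist_nonneg (x := s) (y := q)]
  refine LipschitzOnWith.of_dist_le_mul fun p hp q hq => ?_
  by_cases hpU : p ∈ U <;> by_cases hqU : q ∈ U
  · simpa [hpU, hqU] using hg.dist_le_mul p hp q hq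
  · simpa [hpU, hqU] using key p hp q hq hpU hqU
  · simpa [hpU, hqU, Real.dist_eq, dist_comm] using key q hq p hp hqU hpU
  · simp only [indicator_of_notMem hpU, indicator_of_notMem hqU, dist_self]
    positivity

lemma norm_fderiv_indicator_le {n : ℕ} {Ω U W s : Set (Euc n)} {g : Euc n → ℝ}
    {K : ℝ≥0} {w : Euc n} (hOpen : IsOpen Ω) (hU : IsOpen U)
    (hrest : IsOpen ((Ω ∩ W) \ U)) (hg0 : ∀ w, w ∉ W → g w = 0)
    (hw : w ∈ Ω) (hs : s ∈ nhds w) (hg : LipschitzOnWith K g s) :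
    ‖fderiv ℝ (U.indicator g) w‖ ≤ K := by
  obtain ⟨δ, hδ, hball⟩ := Metric.mem_nhds_iff.1 (Filter.inter_mem hs (hOpen.mem_nhds hw))
  refine norm_fderiv_le_of_lipschitzOn ℝ (ball_mem_nhds w hδ) ?_
  exact (hg.mono (hball.trans inter_subset_left)).indicator_of_clopen_piece (convex_ball w δ)
    (hball.trans inter_subset_right) hU hrest hg0

lemma locallyLipschitzOnSet_indicator {n : ℕ} {Ω U W : Set (Euc n)} {g : Euc n → ℝ}
    {K : ℝ≥0} (hOpen : IsOpen Ω) (hU : IsOpen U)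
    (hrest : IsOpen ((Ω ∩ W) \ U)) (hg0 : ∀ w, w ∉ W → g w = 0)
    (hg : LipschitzWith K g) : LocallyLipschitzOnSet (U.indicator g) Ω := by
  intro w hw
  obtain ⟨δ, hδ, hball⟩ := Metric.mem_nhds_iff.1 (hOpen.mem_nhds hw)
  exact ⟨K, ball w δ, mem_nhdsWithin_of_mem_nhds (ball_mem_nhds w hδ),
    hg.lipschitzOnWith.indicator_of_clopen_piece (convex_ball w δ) hball hU hrest hg0⟩

/-- The radial function equal to `1` on `ball x s`, to `0` off `ball x t`, linear in between. -/
def linearCutoff {n : ℕ} (x : Euc n) (s t : ℝ) (w : Euc n) : ℝ :=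
  max 0 (min 1 ((t - dist w x) / (t - s)))

lemma linearCutoff_eq_one {n : ℕ} {x w : Euc n} {s t : ℝ} (hst : s < t) (hw : dist w x ≤ s) :
    linearCutoff x s t w = 1 := by
  have : 1 ≤ (t - dist w x) / (t - s) := by
    rw [le_div_iff₀ (by linarith)]; linarith
  rw [linearCutoff, min_eq_left this, max_eq_right zero_le_one]

lemma linearCutoff_eq_zero {n : ℕ} {x w : Euc n} {s t : ℝ} (hst : s < t) (hw : t ≤ dist w x) :
    linearCutoff x s t w = 0 := by
  have : (t - dist w x) / (t - s) ≤ 0 :=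
    div_nonpos_of_nonpos_of_nonneg (by linarith) (by linarith)
  rw [linearCutoff, max_eq_left ((min_le_right _ _).trans this)]

lemma lipschitzWith_linearCutoff {n : ℕ} (x : Euc n) {s t : ℝ} (hst : s < t) :
    LipschitzWith (Real.toNNReal (1 / (t - s))) (linearCutoff x s t) := by
  have h0 : 0 < t - s := by linarith
  have : LipschitzWith (Real.toNNReal (1 / (t - s))) fun w : Euc n => (t - dist w x) / (t - s) := by
    refine LipschitzWith.of_dist_le_mul fun p q => ?_
    rw [Real.coe_toNNReal _ (by positivity), Real.dist_eq, ← _root_.sub_div, abs_div, abs_of_pos h0,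
      one_div_mul_eq_div]
    gcongr
    rw [show t - dist p x - (t - dist q x) = -(dist p x - dist q x) by ring, abs_neg]
    exact abs_dist_sub_le p q x
  exact (this.const_min 1).const_max 0

lemma lintegral_fderiv_indicator_linearCutoff_le {n : ℕ} (hn : 2 ≤ n) {Ω U : Set (Euc n)}
    {x : Euc n} {r s t : ℝ} (hOpen : IsOpen Ω) (hU : IsOpen U)
    (hrest : IsOpen ((Ω ∩ ball x r) \ U)) (hst : s < t) (htr : t ≤ r) :
    ∫⁻ w in Ω, ENNReal.ofReal ‖fderiv ℝ (U.indicator (linearCutoff x s t)) w‖ ^ (n : ℝ) ∂volume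
      ≤ ENNReal.ofReal ((1 / (t - s)) ^ n) * volume ((U ∩ ball x t) \ ball x s) := by
  have hne : Nonempty (Fin n) := ⟨⟨0, by omega⟩⟩
  have : Nontrivial (Euc n) := inferInstance
  have h0 : 0 < t - s := by linarith
  have hg0 : ∀ w, w ∉ ball x r → linearCutoff x s t w = 0 := by
    intro w hw
    rw [mem_ball, not_lt] at hw
    exact linearCutoff_eq_zero hst (htr.trans hw)
  set T := (U ∩ ball x t) \ ball x s with hT
  have hTm : MeasurableSet T := (hU.inter isOpen_ball).measurableSet.diff measurableSet_ball
  have hs0 : ∀ᵐ w : Euc n, w ∉ sphere x s :=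
    measure_eq_zero_iff_ae_notMem.1 (Measure.addHaar_sphere volume x s)
  have ht0 : ∀ᵐ w : Euc n, w ∉ sphere x t :=
    measure_eq_zero_iff_ae_notMem.1 (Measure.addHaar_sphere volume x t)
  have hpt : ∀ᵐ w ∂(volume.restrict Ω),
      ENNReal.ofReal ‖fderiv ℝ (U.indicator (linearCutoff x s t)) w‖ ^ (n : ℝ) ≤
        T.indicator (fun _ => ENNReal.ofReal ((1 / (t - s)) ^ n)) w := by
    filter_upwards [ae_restrict_mem hOpen.measurableSet, ae_restrict_of_ae hs0,
      ae_restrict_of_ae ht0] with w hw hws hwt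
    rw [mem_sphere] at hws hwt
    have hzero : ‖fderiv ℝ (U.indicator (linearCutoff x s t)) w‖ ≤ (0 : ℝ≥0) →
      ENNReal.ofReal ‖fderiv ℝ (U.indicator (linearCutoff x s t)) w‖ ^ (n : ℝ) ≤
        T.indicator (fun _ => ENNReal.ofReal ((1 / (t - s)) ^ n)) w := by
      intro h
      rw [NNReal.coe_zero] at h
      rw [ENNReal.ofReal_eq_zero.2 h, ENNReal.zero_rpow_of_pos (by positivity)]
      exact zero_le
    rcases lt_or_gt_of_ne hws with h | h
    · refine hzero (norm_fderiv_indicator_le hOpen hU hrest hg0 hw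
        (isOpen_ball.mem_nhds (mem_ball.2 h)) ?_)
      refine LipschitzOnWith.of_dist_le_mul fun p hp q hq => ?_
      rw [linearCutoff_eq_one hst (mem_ball.1 hp).le, linearCutoff_eq_one hst (mem_ball.1 hq).le]
      simp
    rcases lt_or_gt_of_ne hwt with h' | h'
    swap
    · have ho : IsOpen {p : Euc n | t < dist p x} := isOpen_lt continuous_const (by fun_prop)
      refine hzero (norm_fderiv_indicator_le hOpen hU hrest hg0 hw (ho.mem_nhds h') ?_)
      refine LipschitzOnWith.of_dist_le_mul fun p hp q hq => ?_
      rw [linearCutoff_eq_zero hst (le_of_lt hp), linearCutoff_eq_zero hst (le_of_lt hq)]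
      simp
    by_cases hwU : w ∈ U
    · have hwT : w ∈ T := ⟨⟨hwU, mem_ball.2 h'⟩, by rw [mem_ball]; linarith⟩
      rw [indicator_of_mem hwT, ENNReal.rpow_natCast, ENNReal.ofReal_pow (by positivity)]
      gcongr
      have := norm_fderiv_indicator_le hOpen hU hrest hg0 hw Filter.univ_mem
        (lipschitzWith_linearCutoff x hst).lipschitzOnWith
      rwa [Real.coe_toNNReal _ (by positivity)] at this
    · have hwR : w ∈ (Ω ∩ ball x r) \ U := ⟨⟨hw, mem_ball.2 (h'.trans_le htr)⟩, hwU⟩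
      refine hzero (norm_fderiv_le_of_lipschitzOn ℝ (hrest.mem_nhds hwR) ?_)
      refine LipschitzOnWith.of_dist_le_mul fun p hp q hq => ?_
      rw [indicator_of_notMem hp.2, indicator_of_notMem hq.2]
      simp
  calc _ ≤ ∫⁻ w in Ω, T.indicator (fun _ => ENNReal.ofReal ((1 / (t - s)) ^ n)) w ∂volume :=
        lintegral_mono_ae hpt
    _ ≤ ∫⁻ w, T.indicator (fun _ => ENNReal.ofReal ((1 / (t - s)) ^ n)) w ∂volume :=
        setLIntegral_le_lintegral _ _
    _ = _ := by rw [lintegral_indicator hTm, setLIntegral_const]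

/-- A continuous increasing function with `h 0 = 0` for which halving the value costs at most
`(K * h t) ^ (1 / q)` in the argument grows at least like `t ^ q`. -/
lemma pow_le_of_halving_step {q : ℕ} (hq : q ≠ 0) {h : ℝ → ℝ} {a K : ℝ} (ha : 0 < a)
    (hK : 0 ≤ K) (hcont : ContinuousOn h (Icc 0 a)) (hmono : MonotoneOn h (Icc 0 a))
    (h0 : h 0 = 0) (hpos : ∀ s, 0 < s → s ≤ a → 0 < h s)
    (hstep : ∀ s t, 0 ≤ s → s < t → t ≤ a → h s = h t / 2 → (t - s) ^ q ≤ K * h t) :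
    a ^ q ≤ K * h a / (1 - (1 / 2 : ℝ) ^ ((1 : ℝ) / q)) ^ q := by
  have hq0 : (0 : ℝ) < q := by positivity
  set θ := (1 / 2 : ℝ) ^ ((1 : ℝ) / q) with hθ
  have hθ1 : θ < 1 := Real.rpow_lt_one (by norm_num) (by norm_num) (by positivity)
  have hD : 0 < 1 - θ := by linarith
  set α : ℝ → ℝ := fun t => (K * h t) ^ ((1 : ℝ) / q) with hα
  have hnn : ∀ s, 0 ≤ s → s ≤ a → 0 ≤ h s := fun s hs hsa => by
    rw [← h0]; exact hmono ⟨le_rfl, ha.le⟩ ⟨hs, hsa⟩ hs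
  have hiter : ∀ j : ℕ, ∃ s, 0 < s ∧ s ≤ a ∧ h s = h a / 2 ^ j ∧
      (1 - θ) * (a - s) ≤ α a - α s := by
    intro j
    induction j with
    | zero => exact ⟨a, ha, le_rfl, by simp, by simp⟩
    | succ j ih =>
      obtain ⟨t, ht0, hta, hht, hle⟩ := ih
      have htpos := hpos t ht0 hta
      obtain ⟨s, ⟨hs0, hst⟩, hhs⟩ : h t / 2 ∈ h '' Icc 0 t :=
        intermediate_value_Icc ht0.le (hcont.mono (Icc_subset_Icc_right hta))
          ⟨by rw [h0]; positivity, by linarith⟩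
      have hs0' : 0 < s := by
        rcases hs0.eq_or_lt with h | h
        · rw [← h, h0] at hhs; linarith
        · exact h
      have hst' : s < t := by
        rcases hst.eq_or_lt with h | h
        · rw [h] at hhs; linarith
        · exact h
      refine ⟨s, hs0', hst.trans hta, by rw [hhs, hht, pow_succ]; field_simp, ?_⟩
      have h1 : α s = θ * α t := by
        simp only [hα, hθ]
        rw [hhs, ← Real.mul_rpow (by norm_num) (by positivity)]
        congr 1; ring
      have h2 : t - s ≤ α t := by
        have := hstep s t hs0 hst' hta hhs
        calc t - s = ((t - s) ^ q) ^ ((1 : ℝ) / q) := by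
              rw [one_div, Real.pow_rpow_inv_natCast (by linarith) hq]
          _ ≤ α t := Real.rpow_le_rpow (pow_nonneg (by linarith) _) this (by positivity)
      rw [h1]
      nlinarith
  have hbound : (1 - θ) * a ≤ α a := by
    refine le_of_forall_pos_le_add fun δ hδ => ?_
    set δ' := min δ a
    have hδ' : 0 < δ' := lt_min hδ ha
    have hh := hpos δ' hδ' (min_le_right _ _)
    obtain ⟨j, hj⟩ := pow_unbounded_of_one_lt (h a / h δ') (one_lt_two)
    obtain ⟨s, hs0, hsa, hhs, hle⟩ := hiter j
    have hsδ : s ≤ δ' := by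
      by_contra! hcon
      have := hmono ⟨hδ'.le, min_le_right _ _⟩ ⟨hs0.le, hsa⟩ hcon.le
      rw [hhs, le_div_iff₀ (by positivity)] at this
      rw [div_lt_iff₀ hh] at hj
      linarith
    have hαs : 0 ≤ α s := Real.rpow_nonneg (mul_nonneg hK (hnn s hs0.le hsa)) _
    have hθ0 : 0 ≤ θ := by positivity
    have : s ≤ δ := hsδ.trans (min_le_left _ _)
    nlinarith
  rw [le_div_iff₀ (by positivity), mul_comm, ← mul_pow]
  calc ((1 - θ) * a) ^ q ≤ α a ^ q := by gcongr
    _ = K * h a := by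
      simp only [hα]
      rw [one_div, Real.rpow_inv_natCast_pow (mul_nonneg hK (hnn a ha.le le_rfl)) hq]

lemma IsOpen.diff_connectedComponentIn {n : ℕ} {O : Set (Euc n)} (hO : IsOpen O) (x : Euc n) :
    IsOpen (O \ connectedComponentIn O x) := by
  rw [isOpen_iff_mem_nhds]
  rintro w ⟨hwO, hwx⟩
  refine Filter.mem_of_superset (hO.connectedComponentIn.mem_nhds (mem_connectedComponentIn hwO))
    fun y hy => ⟨connectedComponentIn_subset _ _ hy, fun hyx => hwx ?_⟩
  rw [connectedComponentIn_eq hyx, ← connectedComponentIn_eq hy]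
  exact mem_connectedComponentIn hwO

/-- A clopen piece of `Ω ∩ W` contained in a closed subset of `W` is all of `Ω`. -/
lemma subset_of_clopen_piece_subset_closed {n : ℕ} {Ω W U T : Set (Euc n)} (hOpen : IsOpen Ω)
    (hConn : IsConnected Ω) (hU : IsOpen U) (hUΩ : U ⊆ Ω) (hne : U.Nonempty)
    (hrest : IsOpen ((Ω ∩ W) \ U)) (hT : IsClosed T) (hTW : T ⊆ W) (hUT : U ⊆ T) : Ω ⊆ U := by
  have hW : Ω \ U = ((Ω ∩ W) \ U) ∪ (Ω \ T) := by
    ext w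
    have h1 := @hTW w
    have h2 := @hUT w
    simp only [mem_sdiff, mem_union, mem_inter_iff]
    tauto
  have ho : IsOpen (Ω \ U) := by
    rw [hW]; exact hrest.union (hOpen.sdiff hT)
  by_contra hcon
  obtain ⟨y, hy, hyU⟩ := not_subset.1 hcon
  obtain ⟨x, hx⟩ := hne
  obtain ⟨z, -, hz1, hz2⟩ := hConn.isPreconnected U (Ω \ U) hU ho
    (fun w hw => by by_cases h : w ∈ U; exacts [Or.inl h, Or.inr ⟨hw, h⟩])
    ⟨x, hUΩ hx, hx⟩ ⟨y, hy, hy, hyU⟩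
  exact hz2.2 hz1

/-- Under the local Trudinger inequality, the component of `Ω ∩ ball x r` containing `x` has
volume comparable to `r ^ n`. -/
lemma LocalSPn.exists_volume_component_ge {n : ℕ} (hn : 2 ≤ n) {Ω : Set (Euc n)}
    (hOpen : IsOpen Ω) (hConn : IsConnected Ω) (hSP : LocalSPn n Ω) :
    ∃ c : ℝ, 0 < c ∧ ∀ x ∈ Ω, ∀ r : ℝ, 0 < r → 2 * r < diam Ω →
      ENNReal.ofReal (c * r ^ n) ≤ volume (connectedComponentIn (Ω ∩ ball x r) x) := by
  have hne : Nonempty (Fin n) := ⟨⟨0, by omega⟩⟩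
  have : Nontrivial (Euc n) := inferInstance
  obtain ⟨c, hc, hcap⟩ := hSP.exists_two_sets_bound hn hOpen
  set D := (1 - (1 / 2 : ℝ) ^ ((1 : ℝ) / (2 * n : ℕ))) ^ (2 * n) with hD
  have hD0 : 0 < D := by
    have : (1 / 2 : ℝ) ^ ((1 : ℝ) / (2 * n : ℕ)) < 1 :=
      Real.rpow_lt_one (by norm_num) (by norm_num) (by positivity)
    have : 0 < 1 - (1 / 2 : ℝ) ^ ((1 : ℝ) / (2 * n : ℕ)) := by linarith
    positivity
  refine ⟨4 * c * D / 4 ^ n, by positivity, fun x hx r hr hrd => ?_⟩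
  set U := connectedComponentIn (Ω ∩ ball x r) x with hUdef
  have hO : IsOpen (Ω ∩ ball x r) := hOpen.inter isOpen_ball
  have hU : IsOpen U := hO.connectedComponentIn
  have hrest : IsOpen ((Ω ∩ ball x r) \ U) := hO.diff_connectedComponentIn x
  have hUW : U ⊆ Ω ∩ ball x r := connectedComponentIn_subset _ _
  have hxU : x ∈ U := mem_connectedComponentIn ⟨hx, mem_ball_self hr⟩
  set g : ℝ → ℝ := fun s => (volume (U ∩ ball x s)).toReal with hg
  have hfin : ∀ s, volume (U ∩ ball x s) ≠ ⊤ := fun s =>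
    ((measure_mono inter_subset_right).trans_lt measure_ball_lt_top).ne
  have hmono : Monotone g := fun s t hst => ENNReal.toReal_mono (hfin t)
    (measure_mono (inter_subset_inter_right _ (ball_subset_ball hst)))
  have hdiff : ∀ s t, s ≤ t → volume ((U ∩ ball x t) \ ball x s) = ENNReal.ofReal (g t - g s) := by
    intro s t hst
    have h1 : (U ∩ ball x t) \ ball x s = (U ∩ ball x t) \ (U ∩ ball x s) := by
      ext w; simp only [mem_sdiff, mem_inter_iff]; tauto
    rw [h1, measure_sdiff (inter_subset_inter_right _ (ball_subset_ball hst))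
      (hU.inter isOpen_ball).measurableSet.nullMeasurableSet (hfin s),
      ENNReal.ofReal_sub _ ENNReal.toReal_nonneg, ENNReal.ofReal_toReal (hfin t),
      ENNReal.ofReal_toReal (hfin s)]
  set v := (volume (ball (0 : Euc n) 1)).toReal with hv
  have hballvol : ∀ s, 0 ≤ s → (volume (ball x s)).toReal = s ^ n * v := by
    intro s hs
    rw [Measure.addHaar_ball _ _ hs, ENNReal.toReal_mul, ENNReal.toReal_ofReal (by positivity)]
    simp [hv]
  have hlip : ∀ s t, 0 ≤ s → s ≤ t → g t - g s ≤ v * (t ^ n - s ^ n) := by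
    intro s t hs hst
    have h1 : (U ∩ ball x t) \ ball x s ⊆ ball x t \ ball x s :=
      sdiff_subset_sdiff_left inter_subset_right
    have h2 := measure_mono (μ := volume) h1
    rw [hdiff s t hst, measure_sdiff (ball_subset_ball hst)
      measurableSet_ball.nullMeasurableSet measure_ball_lt_top.ne] at h2
    have h3 := ENNReal.toReal_mono (ENNReal.sub_ne_top measure_ball_lt_top.ne) h2
    rw [ENNReal.toReal_ofReal (sub_nonneg.2 (hmono hst)),
      ENNReal.toReal_sub_of_le (measure_mono (ball_subset_ball hst)) measure_ball_lt_top.ne,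
      hballvol t (hs.trans hst), hballvol s hs] at h3
    linarith
  have hcont : ContinuousOn g (Icc 0 r) := by
    intro s hs
    have hb : ∀ t ∈ Icc 0 r, dist (g t) (g s) ≤ v * |t ^ n - s ^ n| := by
      intro t ht
      rw [Real.dist_eq]
      have hv0 : 0 ≤ v := ENNReal.toReal_nonneg
      rcases le_total s t with h | h
      · rw [abs_of_nonneg (sub_nonneg.2 (hmono h))]
        exact (hlip s t hs.1 h).trans (by gcongr; exact le_abs_self _)
      · rw [abs_sub_comm, abs_of_nonneg (sub_nonneg.2 (hmono h)), abs_sub_comm]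
        exact (hlip t s ht.1 h).trans (by gcongr; exact le_abs_self _)
    rw [ContinuousWithinAt, tendsto_iff_dist_tendsto_zero]
    refine squeeze_zero' (Filter.Eventually.of_forall fun _ => dist_nonneg)
      (eventually_mem_nhdsWithin.mono hb) ?_
    have : Continuous fun t : ℝ => v * |t ^ n - s ^ n| := by fun_prop
    have h := (this.tendsto s).mono_left (nhdsWithin_le_nhds (s := Icc 0 r))
    simpa using h
  have hg0 : g 0 = 0 := by simp [hg]
  have hpos : ∀ s, 0 < s → 0 < g s := fun s hs =>
    ENNReal.toReal_pos ((hU.inter isOpen_ball).measure_pos _ ⟨x, hxU, mem_ball_self hs⟩).ne'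
      (hfin s)
  have hlt : ∀ s, s < r → g s < g r := by
    intro s hs
    by_contra! hcon
    have hz : volume ((U ∩ ball x r) \ closedBall x s) = 0 := by
      refine le_antisymm ?_ zero_le
      calc _ ≤ volume ((U ∩ ball x r) \ ball x s) :=
            measure_mono (sdiff_subset_sdiff_right ball_subset_closedBall)
        _ = 0 := by rw [hdiff s r hs.le, ENNReal.ofReal_eq_zero]; linarith
    have hemp := ((hU.inter isOpen_ball).sdiff isClosed_closedBall).measure_eq_zero_iff volume |>.1 hz
    have hUT : U ⊆ closedBall x s := by
      intro w hw
      by_contra hw'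
      have : w ∈ (U ∩ ball x r) \ closedBall x s := ⟨⟨hw, (hUW hw).2⟩, hw'⟩
      rw [hemp] at this
      exact this
    have hΩU := subset_of_clopen_piece_subset_closed hOpen hConn hU
      (hUW.trans inter_subset_left) ⟨x, hxU⟩ hrest isClosed_closedBall
      (closedBall_subset_ball hs) hUT
    have : diam Ω ≤ 2 * r := by
      refine (diam_mono (hΩU.trans (hUW.trans inter_subset_right)) isBounded_ball).trans ?_
      exact diam_ball hr.le
    linarith
  have hstar : ∀ s t m, 0 ≤ s → s < t → t ≤ r → g s < g t → m ≤ g s → m ≤ g r - g t →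
      c * m * (t - s) ^ (2 * n) ≤ (g t - g s) ^ 2 * r ^ n := by
    intro s t m hs hst htr hΔ hms hmt
    have hts : 0 < t - s := by linarith
    have hJ0 : 0 < (1 / (t - s)) ^ n * (g t - g s) :=
      mul_pos (by positivity) (by linarith)
    have hE := lintegral_fderiv_indicator_linearCutoff_le hn (x := x) hOpen hU hrest hst htr
    rw [hdiff s t hst.le, ← ENNReal.ofReal_mul (by positivity)] at hE
    have := hcap (U.indicator (linearCutoff x s t))
      (locallyLipschitzOnSet_indicator hOpen hU hrest (fun w hw => by
        rw [mem_ball, not_lt] at hw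
        exact linearCutoff_eq_zero hst (htr.trans hw)) (lipschitzWith_linearCutoff x hst))
      x hx r hr (by linarith) _ hJ0 hE (U ∩ ball x s) ((U ∩ ball x r) \ ball x t)
      (fun w hw => ⟨(hUW hw.1).2, (hUW hw.1).1⟩)
      (fun w hw => ⟨(hUW hw.1.1).2, (hUW hw.1.1).1⟩)
      (hU.inter isOpen_ball).measurableSet
      ((hU.inter isOpen_ball).measurableSet.diff measurableSet_ball)
      (fun w hw => by
        rw [indicator_of_mem hw.1, linearCutoff_eq_one hst (mem_ball.1 hw.2).le])
      (fun w hw => by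
        have := hw.2
        rw [mem_ball, not_lt] at this
        rw [indicator_of_mem hw.1.1, linearCutoff_eq_zero hst this])
      m (ENNReal.ofReal_le_of_le_toReal hms)
      (by rw [hdiff t r htr]; exact ENNReal.ofReal_le_ofReal hmt)
    calc c * m * (t - s) ^ (2 * n)
        ≤ ((1 / (t - s)) ^ n * (g t - g s)) ^ 2 * r ^ n * (t - s) ^ (2 * n) := by gcongr
      _ = (g t - g s) ^ 2 * r ^ n := by
        rw [mul_comm 2 n, pow_mul (t - s), one_div, inv_pow]
        have : (t - s) ^ n ≠ 0 := by positivity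
        field_simp
  have hV : 0 < g r := hpos r hr
  obtain ⟨m0, ⟨hm00, hm0r⟩, hm0⟩ : g r / 2 ∈ g '' Icc 0 r :=
    intermediate_value_Icc hr.le hcont ⟨by rw [hg0]; positivity, by linarith⟩
  have hm0pos : 0 < m0 := by
    rcases hm00.eq_or_lt with h | h
    · rw [← h, hg0] at hm0; linarith
    · exact h
  have hm0lt : m0 < r := by
    rcases hm0r.eq_or_lt with h | h
    · rw [h] at hm0; linarith
    · exact h
  have hfinish : ∀ a, r / 2 ≤ a → a ^ (2 * n) ≤ r ^ n / (2 * c) * (g r / 2) / D →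
      4 * c * D / 4 ^ n * r ^ n ≤ g r := by
    intro a ha hle
    have h1 : (r / 2) ^ (2 * n) ≤ r ^ n / (2 * c) * (g r / 2) / D :=
      le_trans (by gcongr) hle
    have h2 : (r / 2) ^ (2 * n) = r ^ n * (r ^ n / 4 ^ n) := by
      rw [pow_mul, ← div_pow, ← mul_pow]; congr 1; ring
    have h3 : r ^ n / (2 * c) * (g r / 2) / D = r ^ n * (g r / (4 * c * D)) := by
      field_simp; ring
    rw [h2, h3] at h1
    have h4 := le_of_mul_le_mul_left h1 (by positivity)
    rw [le_div_iff₀ (by positivity)] at h4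
    calc _ = r ^ n / 4 ^ n * (4 * c * D) := by ring
      _ ≤ _ := h4
  have hgoal : 4 * c * D / 4 ^ n * r ^ n ≤ g r := by
    have hhalf : ∀ Δ d : ℝ, 0 < Δ → c * (Δ / 2) * d ≤ (Δ / 2) ^ 2 * r ^ n →
        d ≤ r ^ n / (2 * c) * Δ := by
      intro Δ d hΔ h
      have h' : (c * (Δ / 2)) * d ≤ (c * (Δ / 2)) * (r ^ n / (2 * c) * Δ) := by
        refine h.trans (le_of_eq ?_)
        field_simp
      exact le_of_mul_le_mul_left h' (by positivity)
    rcases le_total (r / 2) m0 with hcase | hcase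
    · refine hfinish m0 hcase ?_
      rw [← hm0]
      refine pow_le_of_halving_step (by omega) hm0pos (by positivity)
        (hcont.mono (Icc_subset_Icc_right hm0r)) (hmono.monotoneOn _) hg0
        (fun s hs _ => hpos s hs) ?_
      intro s t hs hst htm hst2
      have hgt : 0 < g t := hpos t (by linarith)
      have hgtm : g t ≤ g m0 := hmono htm
      refine hhalf (g t) _ hgt ?_
      have := hstar s t (g t / 2) hs hst (by linarith) (by linarith) (by linarith) (by linarith)
      rwa [show g t - g s = g t / 2 by linarith] at this
    · refine hfinish (r - m0) (by linarith) ?_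
      have hh : g r / 2 = (fun s => g r - g (r - s)) (r - m0) := by
        simp only [_root_.sub_sub_cancel]; linarith
      rw [hh]
      refine pow_le_of_halving_step (h := fun s => g r - g (r - s)) (by omega) (by linarith) (by positivity)
        ?_ ?_ (by simp) ?_ ?_
      · refine continuousOn_const.sub (hcont.comp (by fun_prop) ?_)
        intro s hs
        exact ⟨by linarith [hs.2], by linarith [hs.1]⟩
      · intro s _ t _ hst
        have : g (r - t) ≤ g (r - s) := hmono (by linarith)
        linarith
      · intro s hs _
        have := hlt (r - s) (by linarith)
        linarith
      · intro s t hs hst htm hst2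
        have hgt := hlt (r - t) (by linarith)
        have hgtm : g m0 ≤ g (r - t) := hmono (by linarith)
        refine hhalf (g r - g (r - t)) _ (by linarith) ?_
        have := hstar (r - t) (r - s) ((g r - g (r - t)) / 2) (by linarith) (by linarith)
          (by linarith) (by linarith) (by linarith) (by linarith)
        rwa [show g (r - s) - g (r - t) = (g r - g (r - t)) / 2 by linarith,
          show r - s - (r - t) = t - s by ring] at this
  exact ENNReal.ofReal_le_of_le_toReal (hgoal.trans
    (ENNReal.toReal_mono ((measure_mono (hUW.trans inter_subset_right)).trans_lt
      measure_ball_lt_top).ne (measure_mono inter_subset_left)))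

/-- The radial function equal to `0` on `ball z ρ`, to `1` off `ball z (2 ^ N * ρ)`, logarithmic in
between. -/
def logCutoff {n : ℕ} (z : Euc n) (ρ : ℝ) (N : ℕ) (w : Euc n) : ℝ :=
  min 1 (Real.log (max (dist w z) ρ / ρ) / (N * Real.log 2))

lemma logCutoff_eq_zero {n : ℕ} {z w : Euc n} {ρ : ℝ} (N : ℕ) (hρ : 0 < ρ) (hw : dist w z ≤ ρ) :
    logCutoff z ρ N w = 0 := by
  rw [logCutoff, max_eq_right hw, div_self hρ.ne', Real.log_one, zero_div, min_eq_right zero_le_one]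

lemma logCutoff_eq_one {n : ℕ} {z w : Euc n} {ρ : ℝ} {N : ℕ} (hN : N ≠ 0) (hρ : 0 < ρ)
    (hw : 2 ^ N * ρ ≤ dist w z) : logCutoff z ρ N w = 1 := by
  have hN' : (0 : ℝ) < N := by positivity
  have hlog : 0 < Real.log 2 := Real.log_pos one_lt_two
  refine min_eq_left ?_
  rw [le_div_iff₀ (by positivity), one_mul, ← Real.log_pow]
  refine Real.log_le_log (by positivity) ?_
  rw [le_div_iff₀ hρ]
  exact hw.trans (le_max_left _ _)

lemma abs_log_sub_log_le {a P Q : ℝ} (ha : 0 < a) (hP : a ≤ P) (hQ : a ≤ Q) :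
    |Real.log P - Real.log Q| ≤ |P - Q| / a := by
  have key : ∀ P Q : ℝ, a ≤ P → a ≤ Q → Real.log P - Real.log Q ≤ |P - Q| / a := by
    intro P Q hP hQ
    have hP0 : 0 < P := ha.trans_le hP
    have hQ0 : 0 < Q := ha.trans_le hQ
    rw [← Real.log_div hP0.ne' hQ0.ne']
    calc Real.log (P / Q) ≤ P / Q - 1 := Real.log_le_sub_one_of_pos (by positivity)
      _ = (P - Q) / Q := by field_simp
      _ ≤ |P - Q| / Q := by gcongr; exact le_abs_self _
      _ ≤ |P - Q| / a := by gcongr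
  rw [abs_le]
  have h1 := key P Q hP hQ
  have h2 := key Q P hQ hP
  rw [abs_sub_comm] at h2
  constructor <;> linarith

lemma lipschitzOnWith_logCutoff {n : ℕ} (z : Euc n) {ρ a : ℝ} {N : ℕ} (hN : N ≠ 0) (hρ : 0 < ρ)
    (ha : 0 < a) :
    LipschitzOnWith (Real.toNNReal (1 / (a * (N * Real.log 2)))) (logCutoff z ρ N)
      {w | a ≤ max (dist w z) ρ} := by
  have hN' : (0 : ℝ) < N := by positivity
  have hlog : 0 < Real.log 2 := Real.log_pos one_lt_two
  refine LipschitzOnWith.of_dist_le_mul fun p hp q hq => ?_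
  have hP0 : 0 < max (dist p z) ρ := hρ.trans_le (le_max_right _ _)
  have hQ0 : 0 < max (dist q z) ρ := hρ.trans_le (le_max_right _ _)
  rw [Real.coe_toNNReal _ (by positivity), Real.dist_eq, logCutoff, logCutoff]
  refine (abs_min_sub_min_le_max 1 _ 1 _).trans ?_
  rw [sub_self, abs_zero, max_eq_right (abs_nonneg _), ← _root_.sub_div, abs_div,
    abs_of_pos (show 0 < (N : ℝ) * Real.log 2 by positivity), Real.log_div hP0.ne' hρ.ne',
    Real.log_div hQ0.ne' hρ.ne', sub_sub_sub_cancel_right, div_le_iff₀ (by positivity)]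
  refine (abs_log_sub_log_le ha hp hq).trans ?_
  have h1 : |max (dist p z) ρ - max (dist q z) ρ| ≤ dist p q := by
    refine (abs_max_sub_max_le_max _ _ _ _).trans ?_
    rw [sub_self, abs_zero, max_eq_left (abs_nonneg _)]
    exact abs_dist_sub_le p q z
  calc |max (dist p z) ρ - max (dist q z) ρ| / a ≤ dist p q / a := by gcongr
    _ = 1 / (a * (N * Real.log 2)) * dist p q * (N * Real.log 2) := by field_simp

lemma lintegral_fderiv_indicator_logCutoff_le {n : ℕ} (hn : 2 ≤ n) {Ω U W : Set (Euc n)}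
    {z : Euc n} {ρ : ℝ} {N : ℕ} {g : Euc n → ℝ} (hOpen : IsOpen Ω) (hU : IsOpen U)
    (hrest : IsOpen ((Ω ∩ W) \ U)) (hg0 : ∀ w, w ∉ W → g w = 0) (hN : N ≠ 0) (hρ : 0 < ρ)
    (hgL : ∀ (K : ℝ≥0) (S : Set (Euc n)), LipschitzOnWith K (logCutoff z ρ N) S →
      LipschitzOnWith K g S) :
    ∫⁻ w in Ω, ENNReal.ofReal ‖fderiv ℝ (U.indicator g) w‖ ^ (n : ℝ) ∂volume
      ≤ ENNReal.ofReal (2 * (volume (ball (0 : Euc n) 1)).toReal * 8 ^ n / N) := by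
  have hN' : (0 : ℝ) < N := by positivity
  have hN1 : (1 : ℝ) ≤ N := by exact_mod_cast Nat.one_le_iff_ne_zero.2 hN
  have hlog : 0 < Real.log 2 := Real.log_pos one_lt_two
  have hlog' : 1 / 2 < Real.log 2 := by linarith [Real.log_two_gt_d9]
  set L := N * Real.log 2 with hL
  have hL0 : 0 < L := by positivity
  set v := (volume (ball (0 : Euc n) 1)).toReal with hv
  have hv0 : 0 ≤ v := ENNReal.toReal_nonneg
  have hpt : ∀ w ∈ Ω, ENNReal.ofReal ‖fderiv ℝ (U.indicator g) w‖ ^ (n : ℝ) ≤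
      ∑ k ∈ Finset.range (N + 1), (ball z (2 ^ (k + 1) * ρ)).indicator
        (fun _ => ENNReal.ofReal ((2 / (2 ^ k * ρ * L)) ^ n)) w := by
    intro w hw
    have hzero : ∀ s ∈ nhds w, LipschitzOnWith 0 (logCutoff z ρ N) s →
        ENNReal.ofReal ‖fderiv ℝ (U.indicator g) w‖ ^ (n : ℝ) ≤
        ∑ k ∈ Finset.range (N + 1), (ball z (2 ^ (k + 1) * ρ)).indicator
          (fun _ => ENNReal.ofReal ((2 / (2 ^ k * ρ * L)) ^ n)) w := by
      intro s hs h
      have h := norm_fderiv_indicator_le hOpen hU hrest hg0 hw hs (hgL 0 s h)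
      rw [NNReal.coe_zero] at h
      rw [ENNReal.ofReal_eq_zero.2 h, ENNReal.zero_rpow_of_pos (by positivity)]
      exact zero_le
    rcases lt_or_ge (dist w z) ρ with h | h
    · refine hzero _ (isOpen_ball.mem_nhds (mem_ball.2 h)) ?_
      refine LipschitzOnWith.of_dist_le_mul fun p hp q hq => ?_
      rw [logCutoff_eq_zero N hρ (mem_ball.1 hp).le, logCutoff_eq_zero N hρ (mem_ball.1 hq).le]
      simp
    rcases le_or_gt (2 ^ (N + 1) * ρ) (dist w z) with h' | h'
    · have ho : IsOpen {p : Euc n | 2 ^ N * ρ < dist p z} := isOpen_lt continuous_const (by fun_prop)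
      refine hzero _ (ho.mem_nhds (lt_of_lt_of_le ?_ h')) ?_
      · gcongr <;> norm_num
      refine LipschitzOnWith.of_dist_le_mul fun p hp q hq => ?_
      rw [logCutoff_eq_one hN hρ (le_of_lt hp), logCutoff_eq_one hN hρ (le_of_lt hq)]
      simp
    obtain ⟨k, hk1, hk2⟩ := exists_nat_pow_near (x := dist w z / ρ) (y := 2)
      ((one_le_div hρ).2 h) one_lt_two
    rw [le_div_iff₀ hρ] at hk1
    rw [div_lt_iff₀ hρ] at hk2
    have hkN : k < N + 1 := by
      have : (2 : ℝ) ^ k * ρ < 2 ^ (N + 1) * ρ := hk1.trans_lt h'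
      exact (pow_lt_pow_iff_right₀ (one_lt_two (α := ℝ))).1 (lt_of_mul_lt_mul_right this hρ.le)
    refine le_trans ?_ (Finset.single_le_sum (f := fun k => (ball z (2 ^ (k + 1) * ρ)).indicator
        (fun _ => ENNReal.ofReal ((2 / (2 ^ k * ρ * L)) ^ n)) w) (fun _ _ => zero_le)
        (Finset.mem_range.2 hkN))
    rw [indicator_of_mem (mem_ball.2 hk2), ENNReal.rpow_natCast,
      ENNReal.ofReal_pow (by positivity)]
    gcongr
    have ho : IsOpen {p : Euc n | 2 ^ k * ρ / 2 < dist p z} :=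
      isOpen_lt continuous_const (by fun_prop)
    have hmem : w ∈ {p : Euc n | 2 ^ k * ρ / 2 < dist p z} := by
      have : 0 < 2 ^ k * ρ := by positivity
      show 2 ^ k * ρ / 2 < dist w z
      linarith
    have := norm_fderiv_indicator_le hOpen hU hrest hg0 hw (ho.mem_nhds hmem)
      (hgL _ _ ((lipschitzOnWith_logCutoff z hN hρ (a := 2 ^ k * ρ / 2) (by positivity)).mono
        fun p hp => show 2 ^ k * ρ / 2 ≤ max (dist p z) ρ from
          (le_of_lt hp).trans (le_max_left (dist p z) ρ)))
    rw [Real.coe_toNNReal _ (by positivity)] at this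
    refine this.trans (le_of_eq ?_)
    rw [← hL]; field_simp
  have hterm : ∀ k : ℕ, ENNReal.ofReal ((2 / (2 ^ k * ρ * L)) ^ n) *
      volume (ball z (2 ^ (k + 1) * ρ)) = ENNReal.ofReal ((4 / L) ^ n * v) := by
    intro k
    have : Nonempty (Fin n) := ⟨⟨0, by omega⟩⟩
    rw [Measure.addHaar_ball _ _ (by positivity), finrank_euclideanSpace_fin,
      ← ENNReal.ofReal_toReal (measure_ball_lt_top (μ := volume) (x := (0 : Euc n)) (r := 1)).ne,
      ← hv, ← ENNReal.ofReal_mul (by positivity), ← ENNReal.ofReal_mul (by positivity), ← mul_assoc,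
      ← mul_pow]
    congr 3
    rw [pow_succ]; field_simp; norm_num
  calc _ ≤ ∫⁻ w in Ω, ∑ k ∈ Finset.range (N + 1), (ball z (2 ^ (k + 1) * ρ)).indicator
        (fun _ => ENNReal.ofReal ((2 / (2 ^ k * ρ * L)) ^ n)) w ∂volume :=
        setLIntegral_mono' hOpen.measurableSet hpt
    _ ≤ ∫⁻ w, ∑ k ∈ Finset.range (N + 1), (ball z (2 ^ (k + 1) * ρ)).indicator
        (fun _ => ENNReal.ofReal ((2 / (2 ^ k * ρ * L)) ^ n)) w ∂volume :=
        setLIntegral_le_lintegral _ _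
    _ = ∑ k ∈ Finset.range (N + 1), ENNReal.ofReal ((4 / L) ^ n * v) := by
        rw [lintegral_finsetSum _ fun k _ => measurable_const.indicator measurableSet_ball]
        refine Finset.sum_congr rfl fun k _ => ?_
        rw [lintegral_indicator measurableSet_ball, setLIntegral_const, hterm]
    _ = ENNReal.ofReal ((N + 1) * ((4 / L) ^ n * v)) := by
        rw [Finset.sum_const, Finset.card_range, nsmul_eq_mul,
          ← ENNReal.ofReal_natCast (N + 1), ← ENNReal.ofReal_mul (by positivity)]
        push_cast
        rfl
    _ ≤ _ := by
        refine ENNReal.ofReal_le_ofReal ?_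
        have h1 : 4 / L ≤ 8 / N := by
          rw [div_le_div_iff₀ hL0 hN', hL]; nlinarith
        have h2 : (4 / L) ^ n ≤ 8 ^ n / N ^ 2 := by
          calc (4 / L) ^ n ≤ (8 / N : ℝ) ^ n := by gcongr
            _ = 8 ^ n / N ^ n := div_pow _ _ _
            _ ≤ 8 ^ n / N ^ 2 := by gcongr
        calc (N + 1) * ((4 / L) ^ n * v) ≤ (N + N) * (8 ^ n / N ^ 2 * v) := by gcongr
          _ = 2 * v * 8 ^ n / N := by field_simp; ring

/-- Two points whose surroundings lie in different clopen pieces cannot be separated by a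
condenser with `N` dyadic scales, if `N` is large. -/
lemma LocalSPn.exists_scale_not_separated {n : ℕ} (hn : 2 ≤ n) {Ω : Set (Euc n)}
    (hOpen : IsOpen Ω) (hConn : IsConnected Ω) (hSP : LocalSPn n Ω) :
    ∃ N : ℕ, 3 ≤ N ∧ ∀ (U W : Set (Euc n)) (z : Euc n) (ρ : ℝ) (g : Euc n → ℝ), IsOpen U →
      IsOpen ((Ω ∩ W) \ U) → (∀ w, w ∉ W → g w = 0) → 0 < ρ →
      (∀ (K : ℝ≥0) (S : Set (Euc n)), LipschitzOnWith K (logCutoff z ρ N) S →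
        LipschitzOnWith K g S) →
      ∀ p ∈ Ω, ∀ q ∈ Ω, ∀ s, 0 < s → 8 * s < diam Ω → dist q p ≤ 7 * s →
      connectedComponentIn (Ω ∩ ball p s) p ⊆ U → Disjoint (connectedComponentIn (Ω ∩ ball q s) q) U →
      (∀ w ∈ ball p s, g w = 1) → False := by
  obtain ⟨c, hc, hcap⟩ := hSP.exists_two_sets_bound hn hOpen
  obtain ⟨c', hc', hreg⟩ := hSP.exists_volume_component_ge hn hOpen hConn
  have : Nonempty (Fin n) := ⟨⟨0, by omega⟩⟩
  have : Nontrivial (Euc n) := inferInstance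
  have hv0 : 0 < (volume (ball (0 : Euc n) 1)).toReal :=
    ENNReal.toReal_pos (measure_ball_pos _ _ one_pos).ne' measure_ball_lt_top.ne
  set K := 2 * (volume (ball (0 : Euc n) 1)).toReal * 8 ^ n with hK
  have hK0 : 0 < K := by positivity
  obtain ⟨N0, hN0⟩ := exists_nat_gt (K ^ 2 * 8 ^ n / (c * c'))
  refine ⟨max N0 3, le_max_right _ _, ?_⟩
  set N := max N0 3
  have hN3 : 3 ≤ N := le_max_right _ _
  have hNN : (N0 : ℝ) ≤ N := by exact_mod_cast le_max_left N0 3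
  have hN3' : (3 : ℝ) ≤ N := by exact_mod_cast hN3
  intro U W z ρ g hU hrest hg0 hρ hgL p hp q hq s hs hsd hpq hE hF hg1
  have hglip : LipschitzWith (Real.toNNReal (1 / (ρ * (N * Real.log 2)))) g := by
    rw [← lipschitzOnWith_univ]
    exact hgL _ _ ((lipschitzOnWith_logCutoff z (by omega) hρ hρ).mono fun w _ =>
      le_max_right (dist w z) ρ)
  have hsub : ∀ a, connectedComponentIn (Ω ∩ ball a s) a ⊆ Ω ∩ ball a s := fun a =>
    connectedComponentIn_subset _ _
  have hmeas : ∀ a, MeasurableSet (connectedComponentIn (Ω ∩ ball a s) a) := fun a =>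
    ((hOpen.inter isOpen_ball).connectedComponentIn).measurableSet
  have hmain := hcap (U.indicator g) (locallyLipschitzOnSet_indicator hOpen hU hrest hg0 hglip)
    p hp (8 * s) (by positivity) hsd (K / N) (by positivity)
    (lintegral_fderiv_indicator_logCutoff_le hn hOpen hU hrest hg0 (by omega) hρ hgL)
    (connectedComponentIn (Ω ∩ ball p s) p) (connectedComponentIn (Ω ∩ ball q s) q)
    (fun w hw => ⟨ball_subset_ball (by linarith) (hsub p hw).2, (hsub p hw).1⟩)
    (fun w hw => ⟨by
      have h1 := mem_ball.1 (hsub q hw).2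
      have h2 := dist_triangle w q p
      rw [mem_ball]; linarith, (hsub q hw).1⟩)
    (hmeas p) (hmeas q)
    (fun w hw => by rw [indicator_of_mem (hE hw), hg1 w (hsub p hw).2])
    (fun w hw => by rw [indicator_of_notMem (hF.notMem_of_mem_left hw)])
    (c' * s ^ n) (hreg p hp s hs (by linarith)) (hreg q hq s hs (by linarith))
  have h1 : (c * c') * s ^ n ≤ ((K / N) ^ 2 * 8 ^ n) * s ^ n := by
    calc (c * c') * s ^ n = c * (c' * s ^ n) := by ring
      _ ≤ _ := hmain
      _ = _ := by rw [mul_pow]; ring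
  have h2 := le_of_mul_le_mul_right h1 (by positivity)
  have h3 : (K / N) ^ 2 * 8 ^ n ≤ K ^ 2 * 8 ^ n / N := by
    rw [div_pow, div_mul_eq_mul_div]
    gcongr
    nlinarith
  have h4 := h2.trans h3
  rw [le_div_iff₀ (by positivity)] at h4
  rw [div_lt_iff₀ (by positivity)] at hN0
  have : (N0 : ℝ) * (c * c') ≤ c * c' * N := by
    rw [mul_comm]; gcongr
  linarith

lemma JoinedByCurveIn.mono {n : ℕ} {S T : Set (Euc n)} {x y : Euc n} (h : JoinedByCurveIn S x y)
    (hST : S ⊆ T) : JoinedByCurveIn T x y := by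
  obtain ⟨γ, hγ, h0, h1, hS⟩ := h
  exact ⟨γ, hγ, h0, h1, fun t ht => hST (hS ht)⟩

lemma joinedByCurveIn_of_mem_connectedComponentIn {n : ℕ} {O : Set (Euc n)} (hO : IsOpen O)
    {x y : Euc n} (hx : x ∈ O) (hy : y ∈ connectedComponentIn O x) : JoinedByCurveIn O x y := by
  have hpc : IsPathConnected (connectedComponentIn O x) :=
    hO.connectedComponentIn.isConnected_iff_isPathConnected.1
      (isConnected_connectedComponentIn_iff.2 hx)
  obtain ⟨γ, hγ⟩ := hpc.joinedIn x (mem_connectedComponentIn hx) y hy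
  refine ⟨γ.extend, γ.continuous_extend.continuousOn, γ.extend_zero, γ.extend_one, ?_⟩
  intro t ht
  rw [γ.extend_apply ht]
  exact connectedComponentIn_subset _ _ (hγ _)

lemma connectedComponentIn_subset_of_mem {n : ℕ} {O O' : Set (Euc n)} {x p : Euc n}
    (hp : p ∈ connectedComponentIn O x) (hpO' : p ∈ O') (hsub : O' ⊆ O) :
    connectedComponentIn O' p ⊆ connectedComponentIn O x := by
  rw [connectedComponentIn_eq hp]
  exact isPreconnected_connectedComponentIn.subset_connectedComponentIn
    (mem_connectedComponentIn hpO') ((connectedComponentIn_subset _ _).trans hsub)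

lemma disjoint_connectedComponentIn {n : ℕ} {O : Set (Euc n)} {x y : Euc n} (hy : y ∈ O)
    (hyx : y ∉ connectedComponentIn O x) :
    Disjoint (connectedComponentIn O y) (connectedComponentIn O x) := by
  rw [Set.disjoint_left]
  intro w hwy hwx
  apply hyx
  rw [connectedComponentIn_eq hwx, ← connectedComponentIn_eq hwy]
  exact mem_connectedComponentIn hy

/-- a bounded domain supporting the local Trudinger inequality
of order `n` is LLC. -/
theorem stmt19 (n : ℕ) (hn : 2 ≤ n)
    (Ω : Set (Euc n)) (hOpen : IsOpen Ω)
    (hConn : IsConnected Ω) (hBdd : Bornology.IsBounded Ω)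
    (hSP : LocalSPn n Ω) :
    IsLLC Ω := by
  obtain ⟨N, hN3, hN⟩ := hSP.exists_scale_not_separated hn hOpen hConn
  have hN0 : N ≠ 0 := by omega
  have hpow : (8 : ℝ) ≤ 2 ^ N := by
    calc (8 : ℝ) = 2 ^ 3 := by norm_num
      _ ≤ 2 ^ N := pow_le_pow_right₀ one_le_two hN3
  have hdist : ∀ p ∈ Ω, ∀ q ∈ Ω, dist p q ≤ diam Ω := fun p hp q hq =>
    dist_le_diam_of_mem hBdd hp hq
  refine ⟨1 / (32 * 2 ^ N), by positivity, ?_, fun z r hr => ⟨?_, ?_⟩⟩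
  · rw [div_le_one (by positivity)]; linarith
  · rintro x ⟨hxΩ, hxr⟩ y ⟨hyΩ, hyr⟩
    rw [mem_ball] at hxr hyr
    set R := 2 ^ N * (2 * r) with hR
    have hR16 : 16 * r ≤ R := by rw [hR]; nlinarith
    have hRb : Ω ∩ ball z R ⊆ Ω ∩ ball z (r / (1 / (32 * 2 ^ N))) := by
      refine inter_subset_inter_right _ (ball_subset_ball ?_)
      rw [hR, div_div_eq_mul_div, div_one]; nlinarith
    have hO : IsOpen (Ω ∩ ball z R) := hOpen.inter isOpen_ball
    have hxO : x ∈ Ω ∩ ball z R := ⟨hxΩ, mem_ball.2 (by linarith)⟩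
    have hyO : y ∈ Ω ∩ ball z R := ⟨hyΩ, mem_ball.2 (by linarith)⟩
    refine (joinedByCurveIn_of_mem_connectedComponentIn hO hxO ?_).mono hRb
    rcases le_or_gt (diam Ω) (8 * r) with hd | hd
    · have hΩ : Ω ∩ ball z R = Ω := by
        refine inter_eq_left.2 fun w hw => ?_
        have h1 := hdist w hw x hxΩ
        have h2 := dist_triangle w x z
        rw [mem_ball]; linarith
      rw [hΩ, hConn.isPreconnected.connectedComponentIn hxΩ]
      exact hyΩ
    by_contra hyU
    have hball : ∀ p, dist p z < r → Ω ∩ ball p r ⊆ Ω ∩ ball z R := by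
      intro p hp
      refine inter_subset_inter_right _ fun w hw => ?_
      have h1 := mem_ball.1 hw
      have h2 := dist_triangle w p z
      rw [mem_ball]; linarith
    refine hN (connectedComponentIn (Ω ∩ ball z R) x) (ball z R) z (2 * r)
      (fun w => 1 - logCutoff z (2 * r) N w) hO.connectedComponentIn
      (hO.diff_connectedComponentIn x) ?_ (by positivity) ?_ x hxΩ y hyΩ r hr hd ?_ ?_ ?_ ?_
    · intro w hw
      rw [mem_ball, not_lt] at hw
      rw [logCutoff_eq_one hN0 (by positivity) hw, sub_self]
    · intro K S h
      refine LipschitzOnWith.of_dist_le_mul fun p hp q hq => ?_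
      rw [dist_sub_left]
      exact h.dist_le_mul p hp q hq
    · have := dist_triangle_right y x z
      linarith
    · exact connectedComponentIn_subset_of_mem (mem_connectedComponentIn hxO)
        ⟨hxΩ, mem_ball_self hr⟩ (hball x hxr)
    · exact (disjoint_connectedComponentIn hyO hyU).mono_left
        (connectedComponentIn_subset_of_mem (mem_connectedComponentIn hyO)
          ⟨hyΩ, mem_ball_self hr⟩ (hball y hyr))
    · intro w hw
      have h1 := mem_ball.1 hw
      have h2 := dist_triangle w x z
      rw [logCutoff_eq_zero N (by positivity) (by linarith), sub_zero]
  · rintro x ⟨hxΩ, hxr⟩ y ⟨hyΩ, hyr⟩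
    rw [mem_ball, not_lt] at hxr hyr
    set ρ := 1 / (32 * 2 ^ N) * r with hρ
    have hρ0 : 0 < ρ := by positivity
    have hρN : 2 ^ N * ρ = r / 32 := by rw [hρ]; field_simp
    have hρr : ρ < r / 32 := by nlinarith
    set W := (closedBall z ρ)ᶜ with hW
    have hWmem : ∀ w, w ∈ W ↔ ρ < dist w z := fun w => by
      rw [hW, mem_compl_iff, mem_closedBall, not_le]
    have hO : IsOpen (Ω ∩ W) := hOpen.inter isClosed_closedBall.isOpen_compl
    have hxO : x ∈ Ω ∩ W := ⟨hxΩ, (hWmem x).2 (by linarith)⟩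
    have hyO : y ∈ Ω ∩ W := ⟨hyΩ, (hWmem y).2 (by linarith)⟩
    have hWb : Ω ∩ W ⊆ Ω \ ball z ρ := fun w hw =>
      ⟨hw.1, fun h => hw.2 (ball_subset_closedBall h)⟩
    refine (joinedByCurveIn_of_mem_connectedComponentIn hO hxO ?_).mono hWb
    by_contra hyU
    have hdisj := disjoint_connectedComponentIn hyO hyU
    have hreach : ∀ a ∈ Ω ∩ W, r ≤ dist a z → ∀ a' ∈ Ω, a' ∉ connectedComponentIn (Ω ∩ W) a →
        ∃ p ∈ connectedComponentIn (Ω ∩ W) a, dist p z = r / 16 := by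
      intro a haO har a' ha' haa'
      have hpre : IsPreconnected (connectedComponentIn (Ω ∩ W) a) :=
        isPreconnected_connectedComponentIn
      obtain ⟨q, hq, hqr⟩ : ∃ q ∈ connectedComponentIn (Ω ∩ W) a, dist q z < r / 16 := by
        by_contra! hcon
        have hT : IsClosed {w : Euc n | r / 16 ≤ dist w z} :=
          isClosed_le continuous_const (by fun_prop)
        refine haa' (subset_of_clopen_piece_subset_closed hOpen hConn hO.connectedComponentIn
          ((connectedComponentIn_subset _ _).trans inter_subset_left)
          ⟨a, mem_connectedComponentIn haO⟩ (hO.diff_connectedComponentIn a) hT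
          (fun w hw => (hWmem w).2 ?_) hcon ha')
        have : r / 16 ≤ dist w z := hw
        linarith
      obtain ⟨p, hp, hpr⟩ := hpre.intermediate_value hq (mem_connectedComponentIn haO)
        (f := fun w => dist w z) (by fun_prop) ⟨hqr.le, by linarith⟩
      exact ⟨p, hp, hpr⟩
    obtain ⟨p, hpU, hp⟩ := hreach x hxO hxr y hyΩ hyU
    obtain ⟨q, hqV, hq⟩ := hreach y hyO hyr x hxΩ fun h =>
      hdisj.notMem_of_mem_left h (mem_connectedComponentIn hxO)
    have hpΩ := (connectedComponentIn_subset _ _ hpU).1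
    have hqΩ := (connectedComponentIn_subset _ _ hqV).1
    have hr32 : 0 < r / 32 := by positivity
    have hfar : ∀ p w : Euc n, dist p z = r / 16 → w ∈ ball p (r / 32) → r / 32 < dist w z := by
      intro p w hp hw
      have h1 := mem_ball'.1 hw
      have h2 := dist_triangle p w z
      linarith
    have hball : ∀ p, dist p z = r / 16 → Ω ∩ ball p (r / 32) ⊆ Ω ∩ W := fun p hp =>
      inter_subset_inter_right _ fun w hw => (hWmem w).2 (hρr.trans (hfar p w hp hw))
    refine hN (connectedComponentIn (Ω ∩ W) x) W z ρ (logCutoff z ρ N) hO.connectedComponentIn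
      (hO.diff_connectedComponentIn x) ?_ hρ0 (fun K S h => h) p hpΩ q hqΩ (r / 32) hr32
      ?_ ?_ ?_ ?_ ?_
    · intro w hw
      rw [hWmem, not_lt] at hw
      exact logCutoff_eq_zero N hρ0 hw
    · have h1 := hdist x hxΩ p hpΩ
      have h2 := dist_triangle x p z
      linarith
    · have := dist_triangle_right q p z
      linarith
    · exact connectedComponentIn_subset_of_mem hpU ⟨hpΩ, mem_ball_self hr32⟩ (hball p hp)
    · exact hdisj.mono_left
        (connectedComponentIn_subset_of_mem hqV ⟨hqΩ, mem_ball_self hr32⟩ (hball q hq))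
    · intro w hw
      exact logCutoff_eq_one hN0 hρ0 (by rw [hρN]; exact (hfar p w hp hw).le)
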